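/- Let O⊆ℂ be an open connected set, n≥1, R>0, and let P(t,τ,ξ)=τ³+a₁(t,ξ)τ²+a₂(t,ξ)τ+a₃(t,ξ), where each a_j(t,ξ) is a polynomial in ξ∈ℝⁿ whose coefficients are analytic functions of t∈O. Suppose that for each ξ∈ℝⁿ with |ξ|≥R there are analytic functions τ₁(·,ξ),τ₂(·,ξ),τ₃(·,ξ):O→ℂ such that P(t,τ,ξ)=(τ−τ₁(t,ξ))(τ−τ₂(t,ξ))(τ−τ₃(t,ξ)) for all t∈O and τ∈ℂ. Let Q(t,τ,ξ) be a polynomial in (τ,ξ) whose coefficients are analytic functions of t∈O. Then for every compact set K⊆O there exists ν∈ℕ such that for every ξ∈ℝⁿ with |ξ|≥R and every j∈{1,2,3}, the function t↦Q(t,τ_j(t,ξ),ξ) is either identically zero on O or has at most ν zeros in K. -/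

import Mathlib

/-- `a(t,ξ)` is a polynomial in `ξ ∈ ℝⁿ` whose coefficients are analytic on `O ⊆ ℂ`. -/
def IsPolyXiAnalyticT (O : Set ℂ) (n : ℕ) (a : ℂ → EuclideanSpace ℝ (Fin n) → ℂ) : Prop :=
  ∃ (d : ℕ) (e : Fin d → Fin n → ℕ) (c : Fin d → ℂ → ℂ),
    (∀ i, DifferentiableOn ℂ (c i) O) ∧
    ∀ t ξ, a t ξ = ∑ i, c i t * ((∏ k, ξ k ^ e i k : ℝ) : ℂ)

/-- `Q(t,τ,ξ)` is a polynomial in `(τ,ξ)` whose coefficients are analytic on `O ⊆ ℂ`. -/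
def IsPolyTauXiAnalyticT (O : Set ℂ) (n : ℕ)
    (Q : ℂ → ℂ → EuclideanSpace ℝ (Fin n) → ℂ) : Prop :=
  ∃ (d : ℕ) (p : Fin d → ℕ) (e : Fin d → Fin n → ℕ) (c : Fin d → ℂ → ℂ),
    (∀ i, DifferentiableOn ℂ (c i) O) ∧
    ∀ t τ ξ, Q t τ ξ = ∑ i, c i t * τ ^ p i * ((∏ k, ξ k ^ e i k : ℝ) : ℂ)

/-- Finite sums `∑ i, c i t * m i x` with coefficients `c i` holomorphic on `O`. -/
def separatedSubalgebra (O : Set ℂ) (X : Type) : Subalgebra ℂ (ℂ → X → ℂ) where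
  carrier := {F | ∃ (ι : Type) (_ : Fintype ι) (c : ι → ℂ → ℂ) (m : ι → X → ℂ),
    (∀ i, DifferentiableOn ℂ (c i) O) ∧ ∀ t x, F t x = ∑ i, m i x * c i t}
  mul_mem' := by
    rintro F G ⟨ι, _, c, m, hc, hF⟩ ⟨κ, _, d, l, hd, hG⟩
    refine ⟨ι × κ, inferInstance, fun p t => c p.1 t * d p.2 t, fun p x => m p.1 x * l p.2 x,
      fun p => (hc p.1).mul (hd p.2), fun t x => ?_⟩
    simp only [Pi.mul_apply, hF, hG, Finset.sum_mul_sum, Fintype.sum_prod_type]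
    exact Finset.sum_congr rfl fun i _ => Finset.sum_congr rfl fun j _ => by ring
  add_mem' := by
    rintro F G ⟨ι, _, c, m, hc, hF⟩ ⟨κ, _, d, l, hd, hG⟩
    refine ⟨ι ⊕ κ, inferInstance, Sum.elim c d, Sum.elim m l, ?_, fun t x => ?_⟩
    · rintro (i | i)
      exacts [hc i, hd i]
    · simp [hF, hG]
  algebraMap_mem' r :=
    ⟨Unit, inferInstance, fun _ _ => 1, fun _ _ => r, fun _ => differentiableOn_const _,
      fun t x => by simp [Pi.algebraMap_apply]⟩

/-- In a finite-dimensional space, a linear map is bounded by any other one with smaller kernel. -/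
lemma exists_norm_le_mul_norm_of_ker_le {V E F : Type*} [AddCommGroup V] [Module ℂ V]
    [FiniteDimensional ℂ V] [NormedAddCommGroup E] [NormedSpace ℂ E] [NormedAddCommGroup F]
    [NormedSpace ℂ F] (L : V →ₗ[ℂ] E) (M : V →ₗ[ℂ] F) (h : LinearMap.ker L ≤ LinearMap.ker M) :
    ∃ C : ℝ, ∀ v, ‖M v‖ ≤ C * ‖L v‖ := by
  let T : LinearMap.range L →ₗ[ℂ] F :=
    (LinearMap.ker L).liftQ M h ∘ₗ L.quotKerEquivRange.symm.toLinearMap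
  refine ⟨‖LinearMap.toContinuousLinearMap T‖, fun v => ?_⟩
  have hT : T ⟨L v, v, rfl⟩ = M v := by
    have : L.quotKerEquivRange.symm ⟨L v, v, rfl⟩ = (LinearMap.ker L).mkQ v := by
      rw [LinearEquiv.symm_apply_eq]
      rfl
    simp [T, this]
  have := (LinearMap.toContinuousLinearMap T).le_opNorm ⟨L v, v, rfl⟩
  simpa [hT] using this

/-- A holomorphic function with many zeros in a small concentric ball is small there. -/
lemma norm_le_mul_prod_of_zeros {a : ℂ} {r ρ : ℝ} (hr : r < ρ) (hρ : 0 < ρ) (S : Finset ℂ)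
    (hS : ∀ s ∈ S, s ∈ Metric.closedBall a r) :
    ∀ (f : ℂ → ℂ) (M : ℝ), DifferentiableOn ℂ f (Metric.closedBall a ρ) →
      (∀ z ∈ Metric.closedBall a ρ, ‖f z‖ ≤ M) → (∀ s ∈ S, f s = 0) →
      ∀ z ∈ Metric.closedBall a ρ, ‖f z‖ ≤ M * ∏ s ∈ S, (‖z - s‖ / (ρ - r)) := by
  induction S using Finset.induction_on with
  | empty => intro f M _ hM _ z hz; simpa using hM z hz
  | insert s S hs ih =>
    intro f M hf hM h0 z hz
    have hsr : s ∈ Metric.closedBall a r := hS s (Finset.mem_insert_self _ _)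
    have hsρ : s ∈ Metric.ball a ρ := Metric.closedBall_subset_ball hr hsr
    have hsn : Metric.closedBall a ρ ∈ nhds s :=
      Filter.mem_of_superset (Metric.isOpen_ball.mem_nhds hsρ) Metric.ball_subset_closedBall
    have hfs : f s = 0 := h0 s (Finset.mem_insert_self _ _)
    have hg : DifferentiableOn ℂ (dslope f s) (Metric.closedBall a ρ) :=
      (Complex.differentiableOn_dslope hsn).2 hf
    have hfg : ∀ w, f w = (w - s) * dslope f s w := fun w => by
      have := sub_smul_dslope f s w
      rw [hfs, sub_zero, smul_eq_mul] at this
      exact this.symm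
    have hρr : 0 < ρ - r := sub_pos.2 hr
    have hbound : ∀ w ∈ Metric.closedBall a ρ, ‖dslope f s w‖ ≤ M / (ρ - r) := by
      intro w hw
      refine Complex.norm_le_of_forall_mem_frontier_norm_le (U := Metric.ball a ρ)
        Metric.isBounded_ball (hg.mono ?_).diffContOnCl ?_ ?_
      · exact Metric.closure_ball_subset_closedBall
      · intro w hw
        rw [frontier_ball a hρ.ne'] at hw
        rw [le_div_iff₀ hρr, mul_comm]
        have h1 := hM w (Metric.sphere_subset_closedBall hw)
        rw [hfg, norm_mul] at h1
        refine le_trans ?_ h1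
        gcongr
        have h2 : dist w a ≤ dist w s + dist s a := dist_triangle _ _ _
        rw [Metric.mem_sphere] at hw
        rw [Metric.mem_closedBall] at hsr
        rw [← dist_eq_norm]
        linarith
      · rwa [closure_ball a hρ.ne']
    have hz0 : ∀ w ∈ S, dslope f s w = 0 := by
      intro w hw
      have h1 := hfg w
      rw [h0 w (Finset.mem_insert_of_mem hw)] at h1
      refine (mul_eq_zero.1 h1.symm).resolve_left (sub_ne_zero.2 ?_)
      rintro rfl
      exact hs hw
    have := ih (fun w hw => hS w (Finset.mem_insert_of_mem hw)) _ _ hg hbound hz0 z hz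
    rw [hfg, norm_mul, Finset.prod_insert hs]
    calc _ ≤ ‖z - s‖ * (M / (ρ - r) * ∏ s ∈ S, (‖z - s‖ / (ρ - r))) := by gcongr
      _ = _ := by ring

/-- The function `f` is zero on `O` or has at most `ν` zeros in `K`. -/
def ZeroOrCardZerosLE (O K : Set ℂ) (ν : ℕ) (f : ℂ → ℂ) : Prop :=
  (∀ t ∈ O, f t = 0) ∨ ∀ S : Finset ℂ, ↑S ⊆ K → (∀ z ∈ S, f z = 0) → S.card ≤ ν

lemma ZeroOrCardZerosLE.mono {O K L : Set ℂ} {ν μ : ℕ} {f : ℂ → ℂ} (hKL : K ⊆ L) (hνμ : ν ≤ μ)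
    (h : ZeroOrCardZerosLE O L ν f) : ZeroOrCardZerosLE O K μ f :=
  h.imp_right fun h S hS hz => (h S (hS.trans hKL) hz).trans hνμ

lemma ZeroOrCardZerosLE.union {O K L : Set ℂ} {ν μ : ℕ} {f : ℂ → ℂ}
    (hK : ZeroOrCardZerosLE O K ν f) (hL : ZeroOrCardZerosLE O L μ f) :
    ZeroOrCardZerosLE O (K ∪ L) (ν + μ) f := by
  classical
  rcases hK with hK | hK
  · exact Or.inl hK
  rcases hL with hL | hL
  · exact Or.inl hL
  refine Or.inr fun S hS hz => ?_
  rw [← Finset.card_filter_add_card_filter_not (s := S) (· ∈ K)]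
  refine add_le_add (hK _ (fun z hz => ?_) fun z h => hz z (Finset.mem_filter.1 h).1)
    (hL _ (fun z hz => ?_) fun z h => hz z (Finset.mem_filter.1 h).1)
  · exact (Finset.mem_filter.1 hz).2
  · obtain ⟨h1, h2⟩ := Finset.mem_filter.1 hz
    exact (hS h1).resolve_left h2

lemma exists_zeroOrCardZerosLE_nhds {O : Set ℂ} (hO : IsOpen O) (hOc : IsPreconnected O)
    {ι : Type*} [Fintype ι] {c : ι → ℂ → ℂ} (hc : ∀ i, DifferentiableOn ℂ (c i) O)
    {a : ℂ} (ha : a ∈ O) :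
    ∃ r > 0, ∃ ν : ℕ, ∀ v : ι → ℂ,
      ZeroOrCardZerosLE O (Metric.closedBall a r) ν fun t => ∑ i, v i * c i t := by
  obtain ⟨ρ, hρ, hρO⟩ := Metric.nhds_basis_closedBall.mem_iff.1 (hO.mem_nhds ha)
  have hr : ρ / 5 < ρ := by linarith
  have hrρ : Metric.closedBall a (ρ / 5) ⊆ Metric.closedBall a ρ :=
    Metric.closedBall_subset_closedBall hr.le
  have hcont : ∀ i, ContinuousOn (c i) (Metric.closedBall a ρ) := fun i =>
    (hc i).continuousOn.mono hρO
  have : CompactSpace (Metric.closedBall a ρ) :=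
    isCompact_iff_compactSpace.1 (isCompact_closedBall a ρ)
  have : CompactSpace (Metric.closedBall a (ρ / 5)) :=
    isCompact_iff_compactSpace.1 (isCompact_closedBall a (ρ / 5))
  let L : (ι → ℂ) →ₗ[ℂ] C(Metric.closedBall a (ρ / 5), ℂ) := Fintype.linearCombination ℂ
    fun i => ⟨(Metric.closedBall a (ρ / 5)).domRestrict (c i), ((hcont i).mono hrρ).domRestrict⟩
  let M : (ι → ℂ) →ₗ[ℂ] C(Metric.closedBall a ρ, ℂ) := Fintype.linearCombination ℂ
    fun i => ⟨(Metric.closedBall a ρ).domRestrict (c i), (hcont i).domRestrict⟩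
  have hL : ∀ v z, L v z = ∑ i, v i * c i z := fun v z => by
    simp [L, Fintype.linearCombination_apply]
  have hM : ∀ v z, M v z = ∑ i, v i * c i z := fun v z => by
    simp [M, Fintype.linearCombination_apply]
  have hd : ∀ v : ι → ℂ, DifferentiableOn ℂ (fun t => ∑ i, v i * c i t) O := fun v =>
    DifferentiableOn.fun_sum fun i _ => (hc i).const_mul (v i)
  have hzero : ∀ v, L v = 0 → ∀ t ∈ O, ∑ i, v i * c i t = 0 := by
    intro v hv
    refine ((hd v).analyticOnNhd hO).eqOn_zero_of_preconnected_of_eventuallyEq_zero hOc ha ?_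
    filter_upwards [Metric.closedBall_mem_nhds a (by positivity : 0 < ρ / 5)] with z hz
    rw [← hL v ⟨z, hz⟩, hv]
    rfl
  obtain ⟨C, hC⟩ := exists_norm_le_mul_norm_of_ker_le L M fun v hv => by
    ext z
    rw [hM, hzero v hv z (hρO z.2)]
    rfl
  obtain ⟨N, hN⟩ := pow_unbounded_of_one_lt C (one_lt_two : (1 : ℝ) < 2)
  refine ⟨ρ / 5, by positivity, N, fun v => ?_⟩
  by_cases hv : L v = 0
  · exact Or.inl (hzero v hv)
  refine Or.inr fun S hS hz => ?_
  have hLv : 0 < ‖L v‖ := norm_pos_iff.2 hv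
  have hsmall : ‖L v‖ ≤ ‖M v‖ * (1 / 2) ^ S.card := by
    refine (ContinuousMap.norm_le _ (by positivity)).2 fun z => ?_
    have h := norm_le_mul_prod_of_zeros hr hρ S (fun s hs => hS hs) (fun t => ∑ i, v i * c i t)
      ‖M v‖ ((hd v).mono hρO) (fun w hw => by
        rw [← hM v ⟨w, hw⟩]
        exact (M v).norm_coe_le_norm _) hz z (hrρ z.2)
    rw [hL]
    refine h.trans ?_
    rw [← Finset.prod_const]
    refine mul_le_mul_of_nonneg_left (Finset.prod_le_prod (fun s _ => ?_) fun s hs => ?_)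
      (norm_nonneg _)
    · exact div_nonneg (norm_nonneg _) (by linarith)
    have h1 := Metric.mem_closedBall.1 z.2
    have h2 := Metric.mem_closedBall'.1 (hS hs)
    have h3 := dist_triangle (z : ℂ) a s
    rw [div_le_iff₀ (by linarith), ← dist_eq_norm]
    linarith
  by_contra! hcard
  have h2 : (2 : ℝ) ^ S.card ≤ C := by
    have h3 : ‖L v‖ * 2 ^ S.card ≤ C * ‖L v‖ := by
      calc _ ≤ ‖M v‖ * (1 / 2) ^ S.card * 2 ^ S.card := by gcongr
        _ = ‖M v‖ := by rw [mul_assoc, ← mul_pow]; norm_num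
        _ ≤ _ := hC v
    rw [mul_comm] at h3
    exact le_of_mul_le_mul_right h3 hLv
  have h4 : (2 : ℝ) ^ N ≤ 2 ^ S.card := pow_le_pow_right₀ one_le_two hcard.le
  linarith

/-- On a compact set, the number of zeros of the nonzero functions in the span of finitely many
holomorphic functions is bounded. -/
lemma exists_zeroOrCardZerosLE_of_mem {O : Set ℂ} (hO : IsOpen O) (hOc : IsPreconnected O)
    {X : Type} {K : Set ℂ} (hK : IsCompact K) (hKO : K ⊆ O) {F : ℂ → X → ℂ}
    (hF : F ∈ separatedSubalgebra O X) :
    ∃ ν : ℕ, ∀ x, ZeroOrCardZerosLE O K ν fun t => F t x := by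
  obtain ⟨ι, _, c, m, hc, hF⟩ := hF
  suffices ∃ ν : ℕ, ∀ v : ι → ℂ, ZeroOrCardZerosLE O K ν fun t => ∑ i, v i * c i t by
    obtain ⟨ν, h⟩ := this
    exact ⟨ν, fun x => by simpa only [hF] using h fun i => m i x⟩
  refine hK.induction_on
    (p := fun K => ∃ ν : ℕ, ∀ v : ι → ℂ, ZeroOrCardZerosLE O K ν fun t => ∑ i, v i * c i t)
    ⟨0, fun v => Or.inr fun S hS _ => ?_⟩ ?_ ?_ ?_
  · rw [Set.subset_empty_iff, Finset.coe_eq_empty] at hS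
    simp [hS]
  · rintro s t hst ⟨ν, h⟩
    exact ⟨ν, fun v => (h v).mono hst le_rfl⟩
  · rintro s t ⟨ν, h⟩ ⟨μ, h'⟩
    exact ⟨ν + μ, fun v => (h v).union (h' v)⟩
  · intro a ha
    obtain ⟨r, hr, ν, h⟩ := exists_zeroOrCardZerosLE_nhds hO hOc hc (hKO ha)
    exact ⟨_, mem_nhdsWithin_of_mem_nhds (Metric.closedBall_mem_nhds a hr), ν, h⟩

/-- A bound for the zeros of the elementary symmetric functions of three holomorphic functions
bounds the zeros of each of them. -/
lemma ZeroOrCardZerosLE.of_symmetric {O K : Set ℂ} (hO : IsOpen O) (hOc : IsPreconnected O)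
    (hKO : K ⊆ O) {ν : ℕ} {f g h e₁ e₂ e₃ : ℂ → ℂ} (hf : DifferentiableOn ℂ f O)
    (hg : DifferentiableOn ℂ g O) (hh : DifferentiableOn ℂ h O)
    (h₁ : ∀ t ∈ O, e₁ t = f t + g t + h t)
    (h₂ : ∀ t ∈ O, e₂ t = f t * g t + f t * h t + g t * h t)
    (h₃ : ∀ t ∈ O, e₃ t = f t * g t * h t)
    (b₁ : ZeroOrCardZerosLE O K ν e₁) (b₂ : ZeroOrCardZerosLE O K ν e₂)
    (b₃ : ZeroOrCardZerosLE O K ν e₃) : ZeroOrCardZerosLE O K ν f := by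
  have hf' := hf.analyticOnNhd hO
  have hg' := hg.analyticOnNhd hO
  have hh' := hh.analyticOnNhd hO
  rcases b₃ with b₃ | b₃
  swap
  · exact Or.inr fun S hS hz => b₃ S hS fun z hzS => by
      rw [h₃ z (hKO (hS hzS)), hz z hzS]
      ring
  rcases ((hf'.mul hg').eq_zero_or_eq_zero_of_mul_eq_zero hh'
    (fun t ht => by simpa [h₃ t ht] using b₃ t ht) hOc) with hfg | hh0
  · rcases hf'.eq_zero_or_eq_zero_of_mul_eq_zero hg' hfg hOc with hf0 | hg0
    · exact Or.inl hf0
    rcases b₂ with b₂ | b₂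
    swap
    · exact Or.inr fun S hS hz => b₂ S hS fun z hzS => by
        rw [h₂ z (hKO (hS hzS)), hz z hzS, hg0 z (hKO (hS hzS))]
        ring
    rcases hf'.eq_zero_or_eq_zero_of_mul_eq_zero hh'
      (fun t ht => by simpa [h₂ t ht, hg0 t ht] using b₂ t ht) hOc with hf0 | hh0
    · exact Or.inl hf0
    refine b₁.imp (fun b t ht => ?_) fun b S hS hz => b S hS fun z hzS => ?_
    · simpa [h₁ t ht, hg0 t ht, hh0 t ht] using b t ht
    · have hzO := hKO (hS hzS)
      simp [h₁ z hzO, hg0 z hzO, hh0 z hzO, hz z hzS]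
  · rcases b₂ with b₂ | b₂
    swap
    · exact Or.inr fun S hS hz => b₂ S hS fun z hzS => by
        rw [h₂ z (hKO (hS hzS)), hz z hzS, hh0 z (hKO (hS hzS))]
        ring
    rcases hf'.eq_zero_or_eq_zero_of_mul_eq_zero hg'
      (fun t ht => by simpa [h₂ t ht, hh0 t ht] using b₂ t ht) hOc with hf0 | hg0
    · exact Or.inl hf0
    refine b₁.imp (fun b t ht => ?_) fun b S hS hz => b S hS fun z hzS => ?_
    · simpa [h₁ t ht, hg0 t ht, hh0 t ht] using b t ht
    · have hzO := hKO (hS hzS)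
      simp [h₁ z hzO, hg0 z hzO, hh0 z hzO, hz z hzS]

/-- The powers of the roots of a monic cubic with coefficients in a subalgebra of functions are
polynomials of degree at most two in the root, with coefficients in the same subalgebra. -/
lemma exists_pow_eq_of_cubic {X : Type} (A : Subalgebra ℂ (ℂ → X → ℂ)) {a₁ a₂ a₃ : ℂ → X → ℂ}
    (h₁ : a₁ ∈ A) (h₂ : a₂ ∈ A) (h₃ : a₃ ∈ A) (p : ℕ) :
    ∃ b₀ ∈ A, ∃ b₁ ∈ A, ∃ b₂ ∈ A, ∀ t x z,
      z ^ 3 + a₁ t x * z ^ 2 + a₂ t x * z + a₃ t x = 0 →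
      z ^ p = b₀ t x + b₁ t x * z + b₂ t x * z ^ 2 := by
  induction p with
  | zero => exact ⟨1, one_mem A, 0, zero_mem A, 0, zero_mem A, by simp⟩
  | succ p ih =>
    obtain ⟨b₀, hb₀, b₁, hb₁, b₂, hb₂, h⟩ := ih
    refine ⟨-(b₂ * a₃), neg_mem (mul_mem hb₂ h₃), b₀ - b₂ * a₂, sub_mem hb₀ (mul_mem hb₂ h₂),
      b₁ - b₂ * a₁, sub_mem hb₁ (mul_mem hb₂ h₁), fun t x z hz => ?_⟩
    simp only [Pi.neg_apply, Pi.mul_apply, Pi.sub_apply]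
    rw [pow_succ, h t x z hz]
    linear_combination b₂ t x * hz

lemma IsPolyXiAnalyticT.mem_separatedSubalgebra {O : Set ℂ} {n : ℕ}
    {a : ℂ → EuclideanSpace ℝ (Fin n) → ℂ} (ha : IsPolyXiAnalyticT O n a) :
    a ∈ separatedSubalgebra O (EuclideanSpace ℝ (Fin n)) := by
  obtain ⟨d, e, c, hc, h⟩ := ha
  exact ⟨Fin d, inferInstance, c, fun i ξ => ((∏ k, ξ k ^ e i k : ℝ) : ℂ), hc, fun t ξ => by
    simp only [h, mul_comm]⟩

/-- The remainder of `Q` modulo a monic cubic. -/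
lemma IsPolyTauXiAnalyticT.exists_eq_of_cubic {O : Set ℂ} {n : ℕ}
    {Q : ℂ → ℂ → EuclideanSpace ℝ (Fin n) → ℂ} (hQ : IsPolyTauXiAnalyticT O n Q)
    {a₁ a₂ a₃ : ℂ → EuclideanSpace ℝ (Fin n) → ℂ}
    (h₁ : a₁ ∈ separatedSubalgebra O (EuclideanSpace ℝ (Fin n)))
    (h₂ : a₂ ∈ separatedSubalgebra O (EuclideanSpace ℝ (Fin n)))
    (h₃ : a₃ ∈ separatedSubalgebra O (EuclideanSpace ℝ (Fin n))) :
    ∃ b₀ ∈ separatedSubalgebra O (EuclideanSpace ℝ (Fin n)),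
    ∃ b₁ ∈ separatedSubalgebra O (EuclideanSpace ℝ (Fin n)),
    ∃ b₂ ∈ separatedSubalgebra O (EuclideanSpace ℝ (Fin n)), ∀ t ξ z,
      z ^ 3 + a₁ t ξ * z ^ 2 + a₂ t ξ * z + a₃ t ξ = 0 →
      Q t z ξ = b₀ t ξ + b₁ t ξ * z + b₂ t ξ * z ^ 2 := by
  obtain ⟨d, p, e, c, hc, hQ⟩ := hQ
  choose b₀ hb₀ b₁ hb₁ b₂ hb₂ h using fun i => exists_pow_eq_of_cubic _ h₁ h₂ h₃ (p i)
  let m : Fin d → ℂ → EuclideanSpace ℝ (Fin n) → ℂ :=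
    fun i t ξ => c i t * ((∏ k, ξ k ^ e i k : ℝ) : ℂ)
  have hm : ∀ i, m i ∈ separatedSubalgebra O (EuclideanSpace ℝ (Fin n)) := fun i =>
    ⟨Unit, inferInstance, fun _ => c i, fun _ ξ => ((∏ k, ξ k ^ e i k : ℝ) : ℂ), fun _ => hc i,
      fun t ξ => by simp only [m, Finset.univ_unique, Finset.sum_singleton, mul_comm]⟩
  refine ⟨∑ i, m i * b₀ i, sum_mem fun i _ => mul_mem (hm i) (hb₀ i),
    ∑ i, m i * b₁ i, sum_mem fun i _ => mul_mem (hm i) (hb₁ i),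
    ∑ i, m i * b₂ i, sum_mem fun i _ => mul_mem (hm i) (hb₂ i), fun t ξ z hz => ?_⟩
  simp only [Finset.sum_apply, Pi.mul_apply, hQ, Finset.sum_mul, ← Finset.sum_add_distrib]
  refine Finset.sum_congr rfl fun i _ => ?_
  rw [h i t ξ z hz]
  simp only [m]
  ring


/-- If the monic cubic `P(t,τ,ξ) = τ³ + a₁τ² + a₂τ + a₃` (coefficients polynomial in `ξ`,
analytic in `t ∈ O`) factors for every `|ξ| ≥ R` with roots `τ_j(·,ξ)` analytic on `O`,
and `Q(t,τ,ξ)` is a polynomial in `(τ,ξ)` with coefficients analytic in `t`, then for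
every compact `K ⊆ O` there is `ν`, independent of `ξ`, such that for every `|ξ| ≥ R` and
every `j`, `t ↦ Q(t,τ_j(t,ξ),ξ)` is identically zero on `O` or has at most `ν` zeros in `K`. -/
theorem stmt_5 (O : Set ℂ) (hO : IsOpen O) (hOconn : IsConnected O)
    (n : ℕ) (hn : 1 ≤ n) (R : ℝ) (hR : 0 < R)
    (a1 a2 a3 : ℂ → EuclideanSpace ℝ (Fin n) → ℂ)
    (ha1 : IsPolyXiAnalyticT O n a1) (ha2 : IsPolyXiAnalyticT O n a2)
    (ha3 : IsPolyXiAnalyticT O n a3)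
    (τ : Fin 3 → ℂ → EuclideanSpace ℝ (Fin n) → ℂ)
    (hτan : ∀ ξ : EuclideanSpace ℝ (Fin n), R ≤ ‖ξ‖ → ∀ j : Fin 3,
      DifferentiableOn ℂ (fun t => τ j t ξ) O)
    (hfac : ∀ ξ : EuclideanSpace ℝ (Fin n), R ≤ ‖ξ‖ → ∀ t ∈ O, ∀ z : ℂ,
      z ^ 3 + a1 t ξ * z ^ 2 + a2 t ξ * z + a3 t ξ
        = (z - τ 0 t ξ) * (z - τ 1 t ξ) * (z - τ 2 t ξ))
    (Q : ℂ → ℂ → EuclideanSpace ℝ (Fin n) → ℂ)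
    (hQ : IsPolyTauXiAnalyticT O n Q)
    (K : Set ℂ) (hK : IsCompact K) (hKO : K ⊆ O) :
    ∃ ν : ℕ, ∀ ξ : EuclideanSpace ℝ (Fin n), R ≤ ‖ξ‖ → ∀ j : Fin 3,
      (∀ t ∈ O, Q t (τ j t ξ) ξ = 0) ∨
      (∀ S : Finset ℂ, ↑S ⊆ K → (∀ z ∈ S, Q z (τ j z ξ) ξ = 0) → S.card ≤ ν) := by
  have hOc := hOconn.isPreconnected
  have h1 := ha1.mem_separatedSubalgebra
  have h2 := ha2.mem_separatedSubalgebra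
  have h3 := ha3.mem_separatedSubalgebra
  obtain ⟨A, hA, B, hB, C, hC, hrem⟩ := hQ.exists_eq_of_cubic h1 h2 h3
  set 𝓐 := separatedSubalgebra O (EuclideanSpace ℝ (Fin n))
  have hs1 : -a1 ∈ 𝓐 := neg_mem h1
  have hs3 : -a3 ∈ 𝓐 := neg_mem h3
  obtain ⟨s1, hs1e⟩ : ∃ s, s = -a1 := ⟨_, rfl⟩
  obtain ⟨s3, hs3e⟩ : ∃ s, s = -a3 := ⟨_, rfl⟩
  rw [← hs1e] at hs1
  rw [← hs3e] at hs3
  obtain ⟨ν₁, hν₁⟩ := exists_zeroOrCardZerosLE_of_mem hO hOc hK hKO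
    (F := 3 * A + B * s1 + C * (s1 ^ 2 - 2 * a2)) (by
      change _ ∈ 𝓐
      repeat' first
        | with_reducible assumption
        | with_reducible apply add_mem
        | with_reducible apply sub_mem
        | with_reducible apply mul_mem
        | with_reducible apply pow_mem
        | exact ofNat_mem 𝓐 _)
  obtain ⟨ν₂, hν₂⟩ := exists_zeroOrCardZerosLE_of_mem hO hOc hK hKO
    (F := 3 * A ^ 2 + 2 * A * B * s1 + 2 * A * C * (s1 ^ 2 - 2 * a2) + B ^ 2 * a2
      + B * C * (s1 * a2 - 3 * s3) + C ^ 2 * (a2 ^ 2 - 2 * s1 * s3)) (by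
      change _ ∈ 𝓐
      repeat' first
        | with_reducible assumption
        | with_reducible apply add_mem
        | with_reducible apply sub_mem
        | with_reducible apply mul_mem
        | with_reducible apply pow_mem
        | exact ofNat_mem 𝓐 _)
  obtain ⟨ν₃, hν₃⟩ := exists_zeroOrCardZerosLE_of_mem hO hOc hK hKO
    (F := A ^ 3 + A ^ 2 * B * s1 + A ^ 2 * C * (s1 ^ 2 - 2 * a2) + A * B ^ 2 * a2
      + A * B * C * (s1 * a2 - 3 * s3) + A * C ^ 2 * (a2 ^ 2 - 2 * s1 * s3) + B ^ 3 * s3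
      + B ^ 2 * C * s1 * s3 + B * C ^ 2 * a2 * s3 + C ^ 3 * s3 ^ 2) (by
      change _ ∈ 𝓐
      repeat' first
        | with_reducible assumption
        | with_reducible apply add_mem
        | with_reducible apply sub_mem
        | with_reducible apply mul_mem
        | with_reducible apply pow_mem
        | exact ofNat_mem 𝓐 _)
  refine ⟨ν₁ + ν₂ + ν₃, fun ξ hξ => ?_⟩
  have b₁ := (hν₁ ξ).mono (μ := ν₁ + ν₂ + ν₃) subset_rfl (by omega)
  have b₂ := (hν₂ ξ).mono (μ := ν₁ + ν₂ + ν₃) subset_rfl (by omega)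
  have b₃ := (hν₃ ξ).mono (μ := ν₁ + ν₂ + ν₃) subset_rfl (by omega)
  have hvieta : ∀ t ∈ O, s1 t ξ = τ 0 t ξ + τ 1 t ξ + τ 2 t ξ ∧
      a2 t ξ = τ 0 t ξ * τ 1 t ξ + τ 0 t ξ * τ 2 t ξ + τ 1 t ξ * τ 2 t ξ ∧
      s3 t ξ = τ 0 t ξ * τ 1 t ξ * τ 2 t ξ := by
    intro t ht
    have e0 := hfac ξ hξ t ht 0
    have e1 := hfac ξ hξ t ht 1
    have e2 := hfac ξ hξ t ht (-1)
    simp only [hs1e, hs3e, Pi.neg_apply]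
    refine ⟨?_, ?_, ?_⟩
    · linear_combination e0 - e1 / 2 - e2 / 2
    · linear_combination (e1 - e2) / 2
    · linear_combination -e0
  have hq : ∀ j, ∀ t ∈ O,
      Q t (τ j t ξ) ξ = A t ξ + B t ξ * τ j t ξ + C t ξ * τ j t ξ ^ 2 := fun j t ht => by
    refine hrem t ξ _ ?_
    rw [hfac ξ hξ t ht]
    fin_cases j <;> simp
  have hd : ∀ j, DifferentiableOn ℂ (fun t => Q t (τ j t ξ) ξ) O := fun j => by
    obtain ⟨d, p, e, c, hc, hQ⟩ := hQ
    simp only [hQ]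
    exact DifferentiableOn.fun_sum fun i _ => ((hc i).mul ((hτan ξ hξ j).pow _)).mul_const _
  have key : ∀ j k l : Fin 3, (∀ f : Fin 3 → ℂ, f j + f k + f l = f 0 + f 1 + f 2 ∧
      f j * f k + f j * f l + f k * f l = f 0 * f 1 + f 0 * f 2 + f 1 * f 2 ∧
      f j * f k * f l = f 0 * f 1 * f 2) →
      ZeroOrCardZerosLE O K (ν₁ + ν₂ + ν₃) fun t => Q t (τ j t ξ) ξ := by
    intro j k l hjkl
    refine ZeroOrCardZerosLE.of_symmetric hO hOc hKO (hd j) (hd k) (hd l)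
      (fun t ht => ?_) (fun t ht => ?_) (fun t ht => ?_) b₁ b₂ b₃ <;>
    obtain ⟨v1, v2, v3⟩ := hvieta t ht <;>
    obtain ⟨s1, s2, s3⟩ := hjkl fun i => Q t (τ i t ξ) ξ
    · rw [s1]
      simp only [hq _ t ht, Pi.add_apply, Pi.mul_apply, Pi.sub_apply, Pi.pow_apply,
        Pi.ofNat_apply, v1, v2]
      ring
    · rw [s2]
      simp only [hq _ t ht, Pi.add_apply, Pi.mul_apply, Pi.sub_apply, Pi.pow_apply,
        Pi.ofNat_apply, v1, v2, v3]
      ring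
    · rw [s3]
      simp only [hq _ t ht, Pi.add_apply, Pi.mul_apply, Pi.sub_apply, Pi.pow_apply,
        Pi.ofNat_apply, v1, v2, v3]
      ring
  intro j
  fin_cases j
  · exact key 0 1 2 fun f => ⟨rfl, rfl, rfl⟩
  · exact key 1 0 2 fun f => ⟨by ring, by ring, by ring⟩
  · exact key 2 0 1 fun f => ⟨by ring, by ring, by ring⟩
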